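/- Let S × A be a measurable space equipped with a probability measure ρ, and let Θ be a measurable space equipped with a probability measure Π (the posterior). Let n ∈ ℕ, and let r⋆ : S×A → ℝ, s⋆ : S×A → ℝⁿ be measurable (the true mean reward and mean next-state functions), and for each θ ∈ Θ let r_θ : S×A → ℝ and s_θ : S×A → ℝⁿ be jointly measurable in (θ, s, a) (the model mean functions). Let σ_r, σ_s : S×A → (0,∞) be measurable. For each (s,a), let the true reward distribution be the real Gaussian N(r⋆(s,a), σ_r²(s,a)), the true next-state distribution be the product over coordinates k of N(s⋆(s,a)_k, σ_s²(s,a)), and define the model distributions for parameter θ analogously with means r_θ(s,a) and s_θ(s,a) and the same variances; let the joint reward–state distributions be the corresponding product measures on ℝ × ℝⁿ. Define the Bayesian mean functions r̄(s,a) := ∫ r_θ(s,a) dΠ(θ) and s̄(s,a) := ∫ s_θ(s,a) dΠ(θ), assumed integrable, and assume all integrands below are integrable. Define E := ∫ [ (r̄(s,a) − r⋆(s,a))² / (2σ_r²(s,a)) + ‖s̄(s,a) − s⋆(s,a)‖² / (2σ_s²(s,a)) ] dρ(s,a) and V := ∫ ∫ [ (r̄(s,a) − r_θ(s,a))² / (2σ_r²(s,a))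 + ‖s̄(s,a) − s_θ(s,a)‖² / (2σ_s²(s,a)) ] dΠ(θ) dρ(s,a). Then ∫ ∫ KL( true joint distribution at (s,a) ‖ model joint distribution at (s,a,θ) ) dΠ(θ) dρ(s,a) = E + V. -/

import Mathlib

open MeasureTheory ProbabilityTheory
open scoped ENNReal Classical

/-- Kullback–Leibler divergence: `∫ log(dP/dQ) dP` when `P ≪ Q` (and the log-likelihood
ratio is integrable), and `+∞` otherwise. -/
noncomputable def klDiv {X : Type*} [MeasurableSpace X] (P Q : Measure X) : ℝ≥0∞ :=
  if P ≪ Q ∧ Integrable (llr P Q) P then ENNReal.ofReal (∫ x, llr P Q x ∂P) else ⊤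

lemma pi_withDensity_aux {ι : Type*} [Fintype ι] (ν μ : ι → Measure ℝ)
    [∀ i, IsProbabilityMeasure (ν i)] [∀ i, IsProbabilityMeasure (μ i)]
    (f : ι → ℝ → ℝ≥0∞) (hf : ∀ i, Measurable (f i))
    (h : ∀ i, μ i = (ν i).withDensity (f i)) :
    Measure.pi μ = (Measure.pi ν).withDensity (fun x => ∏ i, f i (x i)) := by
  refine Measure.pi_eq fun s hs => ?_
  rw [withDensity_apply _ (MeasurableSet.univ_pi hs), ← lintegral_indicator (MeasurableSet.univ_pi hs)]
  have hind : iIndepFun (fun i (x : ι → ℝ) => ((s i).indicator (f i)) (x i)) (Measure.pi ν) :=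
    iIndepFun_pi (fun i => ((hf i).indicator (hs i)).aemeasurable)
  have e : (Set.univ.pi s).indicator (fun x : ι → ℝ => ∏ i, f i (x i))
      = fun x => ∏ i, ((s i).indicator (f i)) (x i) := by
    ext x
    by_cases hx : x ∈ Set.univ.pi s
    · rw [Set.indicator_of_mem hx]
      exact Finset.prod_congr rfl fun i _ => by rw [Set.indicator_of_mem (hx i trivial)]
    · rw [Set.indicator_of_notMem hx]
      simp only [Set.mem_pi, Set.mem_univ, true_imp_iff, not_forall] at hx
      obtain ⟨i, hi⟩ := hx
      exact (Finset.prod_eq_zero (Finset.mem_univ i) (Set.indicator_of_notMem hi _)).symm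
  rw [e, lintegral_prod_eq_prod_lintegral_of_indepFun Finset.univ _ hind
    (fun i => ((hf i).indicator (hs i)).comp (measurable_pi_apply i))]
  refine Finset.prod_congr rfl fun i _ => ?_
  rw [h i, withDensity_apply _ (hs i), ← lintegral_indicator (hs i)]
  exact (measurePreserving_eval ν i).lintegral_comp ((hf i).indicator (hs i))

lemma klDiv_withDensity_exp {X : Type*} [MeasurableSpace X] (P Q : Measure X)
    [IsProbabilityMeasure P] [IsProbabilityMeasure Q] (g : X → ℝ) (hg : Measurable g)
    (h : P = Q.withDensity (fun x => ENNReal.ofReal (Real.exp (g x)))) (hi : Integrable g P) :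
    klDiv P Q = ENNReal.ofReal (∫ x, g x ∂P) := by
  have hac : P ≪ Q := h ▸ withDensity_absolutelyContinuous _ _
  have hll : llr P Q =ᵐ[P] g := by
    have : P.rnDeriv Q =ᵐ[Q] (fun x => ENNReal.ofReal (Real.exp (g x))) := by
      conv_lhs => rw [h]
      exact Measure.rnDeriv_withDensity Q (by fun_prop)
    filter_upwards [hac.ae_le this] with x hx
    rw [llr_def]
    simp only [hx, ENNReal.toReal_ofReal (Real.exp_pos _).le, Real.log_exp]
  rw [klDiv, if_pos ⟨hac, hi.congr hll.symm⟩, integral_congr_ae hll]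

noncomputable def gLL (a b w x : ℝ) : ℝ := ((x - b) ^ 2 - (x - a) ^ 2) / (2 * w)

lemma measurable_gLL (a b w : ℝ) : Measurable (gLL a b w) := by
  unfold gLL; fun_prop

lemma gaussian_withDensity (a b w : ℝ) (hw : 0 < w) :
    gaussianReal a w.toNNReal = (gaussianReal b w.toNNReal).withDensity
      (fun x => ENNReal.ofReal (Real.exp (gLL a b w x))) := by
  have hw' : w.toNNReal ≠ 0 := by simpa using hw
  have := measurable_gLL a b w
  rw [gaussianReal_of_var_ne_zero a hw', gaussianReal_of_var_ne_zero b hw',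
    ← withDensity_mul _ (measurable_gaussianPDF _ _) (by fun_prop)]
  congr 1
  ext x
  simp only [Pi.mul_apply, gaussianPDF, gaussianPDFReal]
  rw [← ENNReal.ofReal_mul (by positivity), mul_assoc _⁻¹, ← Real.exp_add, Real.coe_toNNReal _ hw.le, gLL]
  congr 3
  ring

lemma gLL_eq (a b w : ℝ) : gLL a b w = fun x => ((a - b) / w) * x + (b ^ 2 - a ^ 2) / (2 * w) := by
  ext x
  unfold gLL
  rcases eq_or_ne w 0 with rfl | h
  · simp
  · field_simp; ring

lemma integrable_gLL (a b w : ℝ) (v : NNReal) : Integrable (gLL a b w) (gaussianReal a v) := by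
  rw [gLL_eq]
  have : Integrable (fun x : ℝ => x) (gaussianReal a v) :=
    (memLp_id_gaussianReal (μ := a) (v := v) 1).integrable le_rfl
  exact (this.const_mul _).add (integrable_const _)

lemma integral_gLL (a b w : ℝ) (v : NNReal) :
    ∫ x, gLL a b w x ∂(gaussianReal a v) = (a - b) ^ 2 / (2 * w) := by
  rw [gLL_eq]
  have : Integrable (fun x : ℝ => x) (gaussianReal a v) :=
    (memLp_id_gaussianReal (μ := a) (v := v) 1).integrable le_rfl
  rw [integral_add (this.const_mul _) (integrable_const _), integral_const_mul,
    integral_id_gaussianReal]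
  rcases eq_or_ne w 0 with rfl | h
  · simp
  · simp; field_simp; ring

lemma klDiv_gaussian {n : ℕ} (a b w u : ℝ) (hw : 0 < w) (hu : 0 < u) (c d : Fin n → ℝ) :
    klDiv ((gaussianReal a w.toNNReal).prod
          (Measure.pi fun k : Fin n => gaussianReal (c k) u.toNNReal))
        ((gaussianReal b w.toNNReal).prod
          (Measure.pi fun k : Fin n => gaussianReal (d k) u.toNNReal))
      = ENNReal.ofReal ((a - b) ^ 2 / (2 * w) + (∑ k, (c k - d k) ^ 2) / (2 * u)) := by
  have m1 := measurable_gLL a b w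
  have m2 := fun k => measurable_gLL (c k) (d k) u
  have i1 := integrable_gLL a b w w.toNNReal
  have i2' : ∀ k, Integrable (fun x : Fin n → ℝ => gLL (c k) (d k) u (x k))
      (Measure.pi fun k : Fin n => gaussianReal (c k) u.toNNReal) := fun k =>
    integrable_comp_eval (μ := fun k : Fin n => gaussianReal (c k) u.toNNReal)
      (integrable_gLL (c k) (d k) u u.toNNReal)
  have i2 : Integrable (fun x : Fin n → ℝ => ∑ k, gLL (c k) (d k) u (x k))
      (Measure.pi fun k : Fin n => gaussianReal (c k) u.toNNReal) :=
    integrable_finsetSum _ fun k _ => i2' k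
  rw [klDiv_withDensity_exp _ _
    (fun z : ℝ × (Fin n → ℝ) => gLL a b w z.1 + ∑ k, gLL (c k) (d k) u (z.2 k))]
  · rw [integral_add (i1.comp_fst _) (i2.comp_snd _), integral_fun_fst,
      integral_fun_snd (fun x : Fin n → ℝ => ∑ k, gLL (c k) (d k) u (x k)),
      integral_gLL, integral_finsetSum _ fun k _ => i2' k]
    simp only [probReal_univ, one_smul]
    congr 2
    rw [Finset.sum_div]
    refine Finset.sum_congr rfl fun k _ => ?_
    rw [← integral_gLL (c k) (d k) u u.toNNReal]
    exact integral_comp_eval (μ := fun k : Fin n => gaussianReal (c k) u.toNNReal)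
      (m2 k).aestronglyMeasurable
  · fun_prop
  · have hm : Measurable (fun x : Fin n → ℝ =>
        ∏ k, ENNReal.ofReal (Real.exp (gLL (c k) (d k) u (x k)))) :=
      Finset.measurable_fun_prod _ fun k _ =>
        (Real.measurable_exp.comp ((m2 k).comp (measurable_pi_apply k))).ennreal_ofReal
    have hm1 : Measurable (fun x => ENNReal.ofReal (Real.exp (gLL a b w x))) :=
      (Real.measurable_exp.comp m1).ennreal_ofReal
    rw [gaussian_withDensity a b w hw,
      pi_withDensity_aux (fun k : Fin n => gaussianReal (d k) u.toNNReal)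
        (fun k : Fin n => gaussianReal (c k) u.toNNReal) (fun k x => ENNReal.ofReal (Real.exp (gLL (c k) (d k) u x)))
        (fun k => (Real.measurable_exp.comp (m2 k)).ennreal_ofReal)
        (fun k => gaussian_withDensity (c k) (d k) u hu),
      prod_withDensity hm1 hm]
    congr 1
    ext z
    rw [Real.exp_add, ENNReal.ofReal_mul (Real.exp_pos _).le, Real.exp_sum,
      ENNReal.ofReal_prod_of_nonneg fun _ _ => (Real.exp_pos _).le]
  · exact (i1.comp_fst _).add (i2.comp_snd _)


/-- For the Gaussian world model, the posterior information loss (the `ρ`- and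
posterior-expected KL divergence between the true and model joint reward–next-state
Gaussians) equals the mean-squared-error term `E` plus the predictive-variance term `V`. -/
theorem gaussian_pil_eq_mse_add_var {SA Θ : Type*} [MeasurableSpace SA] [MeasurableSpace Θ]
    (ρ : Measure SA) [IsProbabilityMeasure ρ]
    (prior : Measure Θ) [IsProbabilityMeasure prior]
    (n : ℕ)
    (rstar : SA → ℝ) (sstar : SA → Fin n → ℝ)
    (rmod : Θ → SA → ℝ) (smod : Θ → SA → Fin n → ℝ)
    (σr σs : SA → ℝ)
    (hrstar : Measurable rstar) (hsstar : Measurable sstar)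
    (hrmod : Measurable (Function.uncurry rmod))
    (hsmod : Measurable (Function.uncurry smod))
    (hσr : Measurable σr) (hσs : Measurable σs)
    (hσrpos : ∀ p, 0 < σr p) (hσspos : ∀ p, 0 < σs p)
    (rbar : SA → ℝ) (sbar : SA → Fin n → ℝ)
    (hrbar : ∀ p, rbar p = ∫ θ, rmod θ p ∂prior)
    (hsbar : ∀ p k, sbar p k = ∫ θ, smod θ p k ∂prior)
    (hrint : ∀ p, Integrable (fun θ => rmod θ p) prior)
    (hsint : ∀ p k, Integrable (fun θ => smod θ p k) prior)
    (hEint : Integrable (fun p =>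
      (rbar p - rstar p) ^ 2 / (2 * σr p ^ 2) +
        (∑ k, (sbar p k - sstar p k) ^ 2) / (2 * σs p ^ 2)) ρ)
    (hVinner : ∀ p, Integrable (fun θ =>
      (rbar p - rmod θ p) ^ 2 / (2 * σr p ^ 2) +
        (∑ k, (sbar p k - smod θ p k) ^ 2) / (2 * σs p ^ 2)) prior)
    (hVouter : Integrable (fun p => ∫ θ,
      ((rbar p - rmod θ p) ^ 2 / (2 * σr p ^ 2) +
        (∑ k, (sbar p k - smod θ p k) ^ 2) / (2 * σs p ^ 2)) ∂prior) ρ) :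
    (∫⁻ p, (∫⁻ θ, klDiv
        ((gaussianReal (rstar p) (σr p ^ 2).toNNReal).prod
          (Measure.pi fun k : Fin n => gaussianReal (sstar p k) (σs p ^ 2).toNNReal))
        ((gaussianReal (rmod θ p) (σr p ^ 2).toNNReal).prod
          (Measure.pi fun k : Fin n => gaussianReal (smod θ p k) (σs p ^ 2).toNNReal))
        ∂prior) ∂ρ)
      = ENNReal.ofReal
        ((∫ p, ((rbar p - rstar p) ^ 2 / (2 * σr p ^ 2) +
            (∑ k, (sbar p k - sstar p k) ^ 2) / (2 * σs p ^ 2)) ∂ρ) +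
          ∫ p, (∫ θ, ((rbar p - rmod θ p) ^ 2 / (2 * σr p ^ 2) +
            (∑ k, (sbar p k - smod θ p k) ^ 2) / (2 * σs p ^ 2)) ∂prior) ∂ρ) := by
  have hpt : ∀ p θ, (rstar p - rmod θ p) ^ 2 / (2 * σr p ^ 2) +
      (∑ k, (sstar p k - smod θ p k) ^ 2) / (2 * σs p ^ 2) =
      ((rbar p - rmod θ p) ^ 2 / (2 * σr p ^ 2) +
        (∑ k, (sbar p k - smod θ p k) ^ 2) / (2 * σs p ^ 2)) +
      (((rbar p - rstar p) ^ 2 / (2 * σr p ^ 2) +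
        (∑ k, (sbar p k - sstar p k) ^ 2) / (2 * σs p ^ 2)) +
      ((rstar p - rbar p) / σr p ^ 2 * (rbar p - rmod θ p) +
        ∑ k, (sstar p k - sbar p k) / σs p ^ 2 * (sbar p k - smod θ p k))) := by
    intro p θ
    have h1 := (hσrpos p).ne'
    have h2 := (hσspos p).ne'
    have e : (∑ k, (sstar p k - smod θ p k) ^ 2) / (2 * σs p ^ 2) =
        (∑ k, (sbar p k - smod θ p k) ^ 2) / (2 * σs p ^ 2) +
        (∑ k, (sbar p k - sstar p k) ^ 2) / (2 * σs p ^ 2) +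
        ∑ k, (sstar p k - sbar p k) / σs p ^ 2 * (sbar p k - smod θ p k) := by
      simp only [Finset.sum_div]
      rw [← Finset.sum_add_distrib, ← Finset.sum_add_distrib]
      refine Finset.sum_congr rfl fun k _ => ?_
      field_simp
      ring
    rw [e]
    field_simp
    ring
  have hc1 : ∀ p, Integrable (fun θ => (rstar p - rbar p) / σr p ^ 2 * (rbar p - rmod θ p)) prior :=
    fun p => ((integrable_const _).sub (hrint p)).const_mul _
  have hc2 : ∀ p k, Integrable
      (fun θ => (sstar p k - sbar p k) / σs p ^ 2 * (sbar p k - smod θ p k)) prior :=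
    fun p k => ((integrable_const _).sub (hsint p k)).const_mul _
  have hc3 : ∀ p, Integrable
      (fun θ => ∑ k, (sstar p k - sbar p k) / σs p ^ 2 * (sbar p k - smod θ p k)) prior :=
    fun p => integrable_finsetSum _ fun k _ => hc2 p k
  have hz1 : ∀ p, ∫ θ, (rstar p - rbar p) / σr p ^ 2 * (rbar p - rmod θ p) ∂prior = 0 := by
    intro p
    rw [integral_const_mul, integral_sub (integrable_const _) (hrint p), ← hrbar]
    simp
  have hz2 : ∀ p, ∫ θ, ∑ k, (sstar p k - sbar p k) / σs p ^ 2 * (sbar p k - smod θ p k) ∂prior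
      = 0 := by
    intro p
    rw [integral_finsetSum _ fun k _ => hc2 p k]
    refine Finset.sum_eq_zero fun k _ => ?_
    rw [integral_const_mul, integral_sub (integrable_const _) (hsint p k), ← hsbar]
    simp
  have hinner : ∀ p, (∫⁻ θ, klDiv
        ((gaussianReal (rstar p) (σr p ^ 2).toNNReal).prod
          (Measure.pi fun k : Fin n => gaussianReal (sstar p k) (σs p ^ 2).toNNReal))
        ((gaussianReal (rmod θ p) (σr p ^ 2).toNNReal).prod
          (Measure.pi fun k : Fin n => gaussianReal (smod θ p k) (σs p ^ 2).toNNReal))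
        ∂prior) = ENNReal.ofReal (((rbar p - rstar p) ^ 2 / (2 * σr p ^ 2) +
            (∑ k, (sbar p k - sstar p k) ^ 2) / (2 * σs p ^ 2)) +
          ∫ θ, ((rbar p - rmod θ p) ^ 2 / (2 * σr p ^ 2) +
            (∑ k, (sbar p k - smod θ p k) ^ 2) / (2 * σs p ^ 2)) ∂prior) := by
    intro p
    have hI := (hVinner p).add ((integrable_const ((rbar p - rstar p) ^ 2 / (2 * σr p ^ 2) +
            (∑ k, (sbar p k - sstar p k) ^ 2) / (2 * σs p ^ 2))).add ((hc1 p).add (hc3 p)))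
    simp_rw [klDiv_gaussian _ _ _ _ (pow_pos (hσrpos p) 2) (pow_pos (hσspos p) 2)]
    rw [← ofReal_integral_eq_lintegral_ofReal]
    · simp_rw [hpt p]
      have h4 := (hc1 p).fun_add (hc3 p)
      rw [integral_add (hVinner p) ((integrable_const _).fun_add h4),
        integral_add (integrable_const _) h4,
        integral_add (hc1 p) (hc3 p), hz1, hz2, integral_const]
      simp only [probReal_univ, one_smul, add_zero]
      rw [add_comm]
    · simp_rw [hpt p]
      exact hI
    · exact Filter.Eventually.of_forall fun θ => by
        simp only [Pi.zero_apply]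
        positivity
  simp_rw [hinner]
  rw [← ofReal_integral_eq_lintegral_ofReal, integral_add hEint hVouter]
  · exact hEint.add hVouter
  exact Filter.Eventually.of_forall fun p => by
    simp only [Pi.zero_apply]
    have : 0 ≤ ∫ θ, ((rbar p - rmod θ p) ^ 2 / (2 * σr p ^ 2) +
            (∑ k, (sbar p k - smod θ p k) ^ 2) / (2 * σs p ^ 2)) ∂prior :=
      integral_nonneg fun θ => by positivity
    positivity
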